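/- Let r > 0 and s, t > 0. For integers d ≥ 2 and ε ∈ (0,1) define the information complexity n(ε,d) = min{n ∈ ℕ : a(d,n+1) ≤ ε}, where a(d,n) = (1 + (k(d,n)·(k(d,n)+d−1))^r)^{−1/2}. Then the following condition holds if and only if (s·r > 1 or t > 1): for every δ > 0 there exists M > 0 such that for all integers d ≥ 2 and all ε ∈ (0,1) with ε^{−1} + d ≥ M, one has ln(n(ε,d)) ≤ δ·(ε^{−s} + d^t). -/

import Mathlib

/-- `C(d,k) = (2k+d)·(k+d−1)!/(k!·d!)`, the dimension of the space of spherical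
polynomials of degree at most `k` on the sphere `S^d`, as a real number. -/
noncomputable def sphC (d k : ℕ) : ℝ :=
  ((2 * k + d : ℕ) : ℝ) * (Nat.factorial (k + d - 1) : ℝ) /
    ((Nat.factorial k : ℝ) * (Nat.factorial d : ℝ))

/-- The approximation numbers `a(d,n) = (1 + (k(d,n)·(k(d,n)+d−1))^r)^{−1/2}` of
`I_d : H^{r,*}(S^d) → L₂(S^d)`, via an index function `kf` with `kf d n = k(d,n)`. -/
noncomputable def aStar (r : ℝ) (d : ℕ) (kf : ℕ → ℕ → ℕ) (n : ℕ) : ℝ :=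
  (1 + ((kf d n : ℝ) * ((kf d n : ℝ) + (d : ℝ) - 1)) ^ r) ^ (-(1 / 2) : ℝ)

/-- The information complexity `n(ε,d) = min{n ∈ ℕ : a(d,n+1) ≤ ε}` of the
approximation problem `I_d : H^{r,*}(S^d) → L₂(S^d)` for the absolute error
criterion. -/
noncomputable def infoComplexity (r : ℝ) (d : ℕ) (kf : ℕ → ℕ → ℕ) (ε : ℝ) : ℕ :=
  sInf {n : ℕ | aStar r d kf (n + 1) ≤ ε}

open Real

lemma sphC_eq {d : ℕ} (hd : 2 ≤ d) (k : ℕ) :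
    sphC d k = (2 * k + d) / (k + d) * (k + d).choose d := by
  obtain ⟨e, rfl⟩ : ∃ e, d = e + 1 := ⟨d - 1, by omega⟩
  have h : (k + (e + 1)).choose (e + 1) * k.factorial * (e + 1).factorial =
      (k + e + 1) * (k + e).factorial := by
    rw [Nat.add_choose_mul_factorial_mul_factorial, ← Nat.factorial_succ]
    rfl
  have h' : ((k + (e + 1)).choose (e + 1) : ℝ) * k.factorial * (e + 1).factorial =
      (k + e + 1) * (k + e).factorial := mod_cast h
  have hk : (k.factorial : ℝ) ≠ 0 := mod_cast k.factorial_ne_zero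
  have he : ((e + 1).factorial : ℝ) ≠ 0 := mod_cast (e + 1).factorial_ne_zero
  have hke : (k : ℝ) + ((e + 1 : ℕ) : ℝ) ≠ 0 := by positivity
  rw [sphC, show k + (e + 1) - 1 = k + e by omega, div_eq_iff (by positivity), div_mul_eq_mul_div,
    div_mul_eq_mul_div, eq_div_iff hke]
  push_cast
  linear_combination (-(2 * (k : ℝ) + (e + 1))) * h'

lemma choose_le_sphC {d : ℕ} (hd : 2 ≤ d) (k : ℕ) : ((k + d).choose d : ℝ) ≤ sphC d k := by
  rw [sphC_eq hd]
  have hd' : (0 : ℝ) < d := mod_cast (by omega : 0 < d)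
  refine le_mul_of_one_le_left (by positivity) ?_
  rw [le_div_iff₀ (by positivity)]
  linarith [(Nat.cast_nonneg k : (0 : ℝ) ≤ k)]

lemma sphC_le_two_mul_choose {d : ℕ} (hd : 2 ≤ d) (k : ℕ) :
    sphC d k ≤ 2 * (k + d).choose d := by
  rw [sphC_eq hd]
  have hd' : (0 : ℝ) < d := mod_cast (by omega : 0 < d)
  gcongr
  rw [div_le_iff₀ (by positivity)]
  linarith

lemma sphC_le_two_mul_pow {d : ℕ} (hd : 2 ≤ d) (k : ℕ) : sphC d k ≤ 2 * ((k : ℝ) + 1) ^ d := by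
  refine (sphC_le_two_mul_choose hd k).trans ?_
  gcongr
  exact_mod_cast Nat.choose_add_le_add_one_pow k d

lemma choose_le_exp_two_mul_sqrt (n k : ℕ) : (n.choose k : ℝ) ≤ exp (2 * √(k * n)) := by
  have h₁ : ((2 * k).factorial : ℝ) ≤ (2 * k) ^ k * k.factorial :=
    mod_cast Nat.factorial_two_mul_le k
  rcases k.eq_zero_or_pos with rfl | hk
  · simp
  have hk' : (0 : ℝ) < k := mod_cast hk
  have h₂ : (2 * √(k * n)) ^ (2 * k) = (2 * k) ^ k * (2 * n) ^ k := by
    rw [pow_mul, mul_pow, sq_sqrt (by positivity), ← mul_pow]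
    congr 1
    ring
  calc (n.choose k : ℝ) ≤ n ^ k / k.factorial := Nat.choose_le_pow_div k n
    _ ≤ (2 * n) ^ k / k.factorial := by
        gcongr
        linarith [(Nat.cast_nonneg n : (0 : ℝ) ≤ n)]
    _ = (2 * √(k * n)) ^ (2 * k) / ((2 * k) ^ k * k.factorial) := by
        rw [h₂, mul_div_mul_left _ _ (by positivity)]
    _ ≤ (2 * √(k * n)) ^ (2 * k) / (2 * k).factorial := by gcongr
    _ ≤ _ := pow_div_factorial_le_exp _ (by positivity) _

lemma sphC_le_two_mul_exp {d : ℕ} (hd : 2 ≤ d) (k : ℕ) :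
    sphC d k ≤ 2 * exp (2 * √(k * (k + d))) := by
  refine (sphC_le_two_mul_choose hd k).trans ?_
  rw [← Nat.choose_symm_add]
  gcongr
  exact_mod_cast choose_le_exp_two_mul_sqrt (k + d) k

lemma two_pow_le_centralBinom (n : ℕ) : 2 ^ n ≤ n.centralBinom := by
  induction n with
  | zero => simp
  | succ n ih =>
    refine Nat.le_of_mul_le_mul_left ?_ n.succ_pos
    rw [Nat.succ_eq_add_one, Nat.succ_mul_centralBinom_succ, pow_succ]
    nlinarith

lemma aStar_le_iff {r : ℝ} (hr : 0 < r) {d : ℕ} (hd : 2 ≤ d) (kf : ℕ → ℕ → ℕ) (n : ℕ) {y : ℝ}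
    (hy : 0 ≤ y) : aStar r d kf n ≤ (1 + y ^ r) ^ (-(1 / 2) : ℝ) ↔
      y ≤ (kf d n : ℝ) * ((kf d n : ℝ) + (d : ℝ) - 1) := by
  have hd' : (2 : ℝ) ≤ d := mod_cast hd
  have hX : 0 ≤ (kf d n : ℝ) * ((kf d n : ℝ) + (d : ℝ) - 1) :=
    mul_nonneg (by positivity) (by linarith [(Nat.cast_nonneg (kf d n) : (0 : ℝ) ≤ _)])
  rw [aStar, rpow_le_rpow_iff_of_neg (by positivity) (by positivity) (by norm_num),
    add_le_add_iff_left, rpow_le_rpow_iff hy hX hr]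

lemma eigenvalue_le_of_lt_aStar {r : ℝ} (hr : 0 < r) {d : ℕ} (hd : 2 ≤ d) {kf : ℕ → ℕ → ℕ} {n : ℕ}
    {ε : ℝ} (hε : 0 < ε) (h : ε < aStar r d kf n) :
    (kf d n : ℝ) * ((kf d n : ℝ) + (d : ℝ) - 1) ≤ (ε⁻¹ ^ (1 / r)) ^ 2 := by
  by_contra! hlt
  refine h.not_ge (((aStar_le_iff hr hd kf n (by positivity)).2 hlt.le).trans ?_)
  have h₁ : ((ε⁻¹ ^ (1 / r)) ^ 2) ^ r = ε⁻¹ ^ 2 := by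
    rw [← rpow_natCast, ← rpow_natCast, ← rpow_mul (by positivity), ← rpow_mul (by positivity)]
    congr 1
    field_simp
  have h₂ : (ε⁻¹ ^ 2) ^ (-(1 / 2) : ℝ) = ε := by
    rw [← rpow_natCast, ← rpow_mul (by positivity)]
    norm_num [rpow_neg_one]
  rw [h₁]
  exact (rpow_le_rpow_of_nonpos (by positivity) (by linarith) (by norm_num)).trans h₂.le

lemma log_infoComplexity_le {r : ℝ} (hr : 0 < r) {kf : ℕ → ℕ → ℕ} {d : ℕ} (hd : 2 ≤ d)
    (hkf : ∀ n : ℕ, 1 ≤ n → (n : ℝ) ≤ sphC d (kf d n)) {ε : ℝ} (hε : 0 < ε) :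
    log (infoComplexity r d kf ε) ≤ log 2 + 3 * ε⁻¹ ^ (1 / r) ∧
    log (infoComplexity r d kf ε) ≤ log 2 + d * log (1 + ε⁻¹ ^ (1 / r)) := by
  have hm : 0 < ε⁻¹ ^ (1 / r) := by positivity
  have hlog2 : 0 < log 2 := log_pos one_lt_two
  rcases Nat.eq_zero_or_pos (infoComplexity r d kf ε) with h0 | hpos
  · have := log_nonneg (by linarith : 1 ≤ 1 + ε⁻¹ ^ (1 / r))
    rw [h0, Nat.cast_zero, log_zero]
    constructor <;> positivity
  have hlt : ε < aStar r d kf (infoComplexity r d kf ε) := by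
    have := Nat.notMem_of_lt_sInf (Nat.sub_one_lt hpos.ne' :
      infoComplexity r d kf ε - 1 < infoComplexity r d kf ε)
    simpa [Nat.sub_add_cancel hpos] using this
  have hX := eigenvalue_le_of_lt_aStar hr hd hε hlt
  have hN := hkf _ hpos
  generalize infoComplexity r d kf ε = N at *
  generalize kf d N = k at *
  generalize ε⁻¹ ^ (1 / r) = m at *
  have hd' : (2 : ℝ) ≤ d := mod_cast hd
  have hk : (0 : ℝ) ≤ k := Nat.cast_nonneg k
  have hN' : (0 : ℝ) < N := mod_cast hpos
  constructor
  · have hs : √((k : ℝ) * (k + d)) ≤ 3 / 2 * m := by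
      rw [sqrt_le_left (by positivity)]
      nlinarith [mul_nonneg hk hk]
    calc log N ≤ log (2 * exp (2 * √(k * (k + d)))) :=
          log_le_log hN' (hN.trans (sphC_le_two_mul_exp hd k))
      _ = log 2 + 2 * √(k * (k + d)) := by
          rw [log_mul two_ne_zero (exp_pos _).ne', log_exp]
      _ ≤ _ := by linarith
  · have hkm : (k : ℝ) ≤ m := by
      refine le_of_sq_le_sq ?_ hm.le
      nlinarith
    calc log N ≤ log (2 * ((k : ℝ) + 1) ^ d) :=
          log_le_log hN' (hN.trans (sphC_le_two_mul_pow hd k))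
      _ = log 2 + d * log (1 + k) := by
          rw [log_mul two_ne_zero (by positivity), log_pow, add_comm (k : ℝ)]
      _ ≤ _ := by gcongr

lemma two_pow_le_infoComplexity {r : ℝ} (hr : 0 < r) {kf : ℕ → ℕ → ℕ} {d : ℕ} (hd : 2 ≤ d)
    (hkf : ∀ n : ℕ, 1 ≤ n →
      (n : ℝ) ≤ sphC d (kf d n) ∧ (0 < kf d n → sphC d (kf d n - 1) < (n : ℝ))) :
    2 ^ d ≤ infoComplexity r d kf ((1 + (2 * (d : ℝ) ^ 2) ^ r) ^ (-(1 / 2) : ℝ)) := by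
  have hd' : (2 : ℝ) ≤ d := mod_cast hd
  have hne : {n : ℕ | aStar r d kf (n + 1) ≤
      (1 + (2 * (d : ℝ) ^ 2) ^ r) ^ (-(1 / 2) : ℝ)}.Nonempty := by
    refine ⟨2 * (2 * d + 1) ^ d, (aStar_le_iff hr hd kf _ (by positivity)).2 ?_⟩
    have h := ((hkf (2 * (2 * d + 1) ^ d + 1) (by omega)).1).trans (sphC_le_two_mul_pow hd _)
    generalize kf d (2 * (2 * d + 1) ^ d + 1) = k at *
    have hk : 2 * d < k := by
      by_contra! hk
      have : (k + 1) ^ d ≤ (2 * d + 1) ^ d := by gcongr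
      have h' : 2 * (2 * d + 1) ^ d + 1 ≤ 2 * (k + 1) ^ d := mod_cast h
      omega
    have hk' : 2 * (d : ℝ) ≤ k := mod_cast hk.le
    nlinarith
  have hmem := (aStar_le_iff hr hd kf (infoComplexity r d kf
    ((1 + (2 * (d : ℝ) ^ 2) ^ r) ^ (-(1 / 2) : ℝ)) + 1) (by positivity)).1 (Nat.sInf_mem hne)
  have hspec := (hkf (infoComplexity r d kf
    ((1 + (2 * (d : ℝ) ^ 2) ^ r) ^ (-(1 / 2) : ℝ)) + 1) (by omega)).2
  generalize infoComplexity r d kf ((1 + (2 * (d : ℝ) ^ 2) ^ r) ^ (-(1 / 2) : ℝ)) = N at *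
  generalize kf d (N + 1) = k at *
  have hk : d < k := by
    by_contra! hk
    have hk' : (k : ℝ) ≤ d := mod_cast hk
    nlinarith [(Nat.cast_nonneg k : (0 : ℝ) ≤ k)]
  have h := (choose_le_sphC hd (k - 1)).trans_lt (hspec (by omega))
  have h' : (k - 1 + d).choose d < N + 1 := mod_cast h
  have h₂ := Nat.choose_le_choose d (by omega : 2 * d ≤ k - 1 + d)
  have h₃ := two_pow_le_centralBinom d
  rw [Nat.centralBinom] at h₃
  omega

lemma exists_rpow_le_mul_rpow_add {a b : ℝ} (ha : 0 < a) (hab : a < b) {δ : ℝ} (hδ : 0 < δ) :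
    ∃ C : ℝ, 0 ≤ C ∧ ∀ x : ℝ, 1 ≤ x → x ^ a ≤ δ * x ^ b + C := by
  refine ⟨((δ⁻¹) ^ (1 / (b - a))) ^ a, by positivity, fun x hx ↦ ?_⟩
  have hx0 : 0 < x := by linarith
  rcases le_total x ((δ⁻¹) ^ (1 / (b - a))) with h | h
  · have := rpow_le_rpow hx0.le h ha.le
    have : 0 ≤ δ * x ^ b := by positivity
    linarith
  · have h₁ : δ⁻¹ ≤ x ^ (b - a) := by
      have := rpow_le_rpow (by positivity) h (sub_pos.2 hab).le
      rwa [← rpow_mul (by positivity), one_div_mul_cancel (sub_pos.2 hab).ne', rpow_one] at this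
    have h₂ : x ^ b = x ^ (b - a) * x ^ a := by rw [← rpow_add hx0]; simp
    have h₃ : 1 ≤ δ * x ^ (b - a) := by
      rwa [inv_le_iff_one_le_mul₀' hδ] at h₁
    have : x ^ a ≤ δ * x ^ b := by
      rw [h₂, ← mul_assoc]
      exact le_mul_of_one_le_left (by positivity) h₃
    have : 0 ≤ ((δ⁻¹) ^ (1 / (b - a))) ^ a := by positivity
    linarith

lemma exists_const_le_mul_rpow_add_rpow {s t : ℝ} (hs : 0 < s) (ht : 0 < t) {δ : ℝ} (hδ : 0 < δ)
    {C : ℝ} (hC : 0 ≤ C) :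
    ∃ M : ℝ, 0 < M ∧ ∀ x y : ℝ, 0 ≤ x → 0 ≤ y → M ≤ x + y → C ≤ δ * (x ^ s + y ^ t) := by
  have key : ∀ {u z : ℝ}, 0 < u → (C / δ) ^ (1 / u) ≤ z → C ≤ δ * z ^ u := by
    intro u z hu hz
    have := rpow_le_rpow (by positivity) hz hu.le
    rw [← rpow_mul (by positivity), one_div_mul_cancel hu.ne', rpow_one] at this
    rwa [div_le_iff₀' hδ] at this
  refine ⟨(C / δ) ^ (1 / s) + (C / δ) ^ (1 / t) + 1, by positivity, fun x y hx hy h ↦ ?_⟩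
  have hx' : 0 ≤ δ * x ^ s := by positivity
  have hy' : 0 ≤ δ * y ^ t := by positivity
  rcases le_total ((C / δ) ^ (1 / s)) x with h₁ | h₁
  · linarith [key hs h₁]
  · linarith [key ht (by linarith : (C / δ) ^ (1 / t) ≤ y)]

lemma exists_mul_log_le {a s t : ℝ} (ha : 0 < a) (hs : 0 < s) (ht : 1 < t) {δ : ℝ} (hδ : 0 < δ) :
    ∃ C : ℝ, 0 ≤ C ∧ ∀ x y : ℝ, 1 ≤ x → 1 ≤ y →
      y * log (1 + x ^ a) ≤ C + δ * (x ^ s + y ^ t) := by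
  obtain ⟨p, hp, hpt⟩ := exists_between ht
  have hpq := HolderConjugate.conjExponent hp
  set q := conjExponent p
  have hq : 1 < q := hpq.symm.lt
  set η := s / (2 * a * q)
  have hη : 0 < η := by positivity
  set K := (2 ^ η / η) ^ q
  have hK : 0 < K := by positivity
  obtain ⟨C₁, hC₁, h₁⟩ := exists_rpow_le_mul_rpow_add (half_pos hs) (half_lt_self hs) (div_pos hδ hK)
  obtain ⟨C₂, hC₂, h₂⟩ := exists_rpow_le_mul_rpow_add (by linarith : 0 < p) hpt hδ
  refine ⟨K * C₁ + C₂, by positivity, fun x y hx hy ↦ ?_⟩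
  have hx0 : 0 < x := by linarith
  have hxa : 1 ≤ x ^ a := one_le_rpow hx ha.le
  have hL : 0 ≤ log (1 + x ^ a) := log_nonneg (by linarith)
  have hlog : log (1 + x ^ a) ≤ 2 ^ η / η * x ^ (a * η) :=
    calc log (1 + x ^ a) ≤ (1 + x ^ a) ^ η / η := log_le_rpow_div (by positivity) hη
      _ ≤ (2 * x ^ a) ^ η / η := by gcongr; linarith
      _ = _ := by rw [mul_rpow (by norm_num) (by positivity), ← rpow_mul hx0.le]; ring
  have hLq : log (1 + x ^ a) ^ q ≤ K * x ^ (s / 2) := by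
    refine (rpow_le_rpow hL hlog (by linarith)).trans_eq ?_
    rw [mul_rpow (by positivity) (by positivity), ← rpow_mul hx0.le]
    congr 2
    simp only [η]
    field_simp
  have hyoung := young_inequality_of_nonneg (by linarith : 0 ≤ y) hL hpq
  have hy1 : y ^ p / p ≤ y ^ p := div_le_self (by positivity) hp.le
  have hL1 : log (1 + x ^ a) ^ q / q ≤ log (1 + x ^ a) ^ q := div_le_self (by positivity) hq.le
  have hmul : K * x ^ (s / 2) ≤ δ * x ^ s + K * C₁ := by
    calc _ ≤ K * (δ / K * x ^ s + C₁) := by gcongr; exact h₁ x hx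
      _ = _ := by field_simp
  linarith [h₂ y hy]

lemma one_lt_or_one_lt_of_two_pow_le {r s t : ℝ} (hr : 0 < r) (hs : 0 < s) {f : ℕ → ℝ → ℕ}
    (hf : ∀ d : ℕ, 2 ≤ d → 2 ^ d ≤ f d ((1 + (2 * (d : ℝ) ^ 2) ^ r) ^ (-(1 / 2) : ℝ)))
    (h : ∀ δ : ℝ, 0 < δ → ∃ M : ℝ, 0 < M ∧
      ∀ d : ℕ, 2 ≤ d → ∀ ε : ℝ, 0 < ε → ε < 1 → M ≤ ε⁻¹ + d →
        log (f d ε) ≤ δ * (ε ^ (-s) + (d : ℝ) ^ t)) :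
    1 < s * r ∨ 1 < t := by
  by_contra! hst
  obtain ⟨hsr, ht⟩ := hst
  set c : ℝ := (2 * 2 ^ r) ^ (s / 2)
  have hc : 0 < c := by positivity
  have hlog2 : 0 < log 2 := log_pos one_lt_two
  obtain ⟨M, -, hM⟩ := h (log 2 / (2 * (c + 1))) (by positivity)
  obtain ⟨d, hd⟩ := exists_nat_ge (max M 2)
  have hd2' : (2 : ℝ) ≤ d := (le_max_right _ _).trans hd
  have hd2 : 2 ≤ d := mod_cast hd2'
  have hd1 : (1 : ℝ) ≤ d := by linarith
  have hY : 1 ≤ (2 * (d : ℝ) ^ 2) ^ r := one_le_rpow (by nlinarith) hr.le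
  have hε : 0 < (1 + (2 * (d : ℝ) ^ 2) ^ r) ^ (-(1 / 2) : ℝ) := by positivity
  have hle := hM d hd2 _ hε (rpow_lt_one_of_one_lt_of_neg (by linarith) (by norm_num))
    (by linarith [inv_pos.2 hε, (le_max_left M 2).trans hd])
  have hlow : d * log 2 ≤ log (f d ((1 + (2 * (d : ℝ) ^ 2) ^ r) ^ (-(1 / 2) : ℝ))) := by
    rw [← log_pow]
    exact log_le_log (by positivity) (mod_cast hf d hd2)
  have hεs : ((1 + (2 * (d : ℝ) ^ 2) ^ r) ^ (-(1 / 2) : ℝ)) ^ (-s) ≤ c * d := by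
    calc _ = (1 + (2 * (d : ℝ) ^ 2) ^ r) ^ (s / 2) := by
          rw [← rpow_mul (by positivity)]
          congr 1
          ring
      _ ≤ (2 * (2 * (d : ℝ) ^ 2) ^ r) ^ (s / 2) := by
          gcongr
          linarith
      _ = c * (d : ℝ) ^ (s * r) := by
          rw [mul_rpow zero_le_two (by positivity : 0 ≤ (d : ℝ) ^ 2), ← mul_assoc,
            mul_rpow (by positivity) (by positivity), ← rpow_natCast, ← rpow_mul (by positivity),
            ← rpow_mul (by positivity)]
          congr 2
          push_cast
          ring
      _ ≤ c * (d : ℝ) ^ (1 : ℝ) := by gcongr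
      _ = _ := by rw [rpow_one]
  have hdt : (d : ℝ) ^ t ≤ d := by
    simpa using rpow_le_rpow_of_exponent_le hd1 ht
  have : d * log 2 ≤ d * log 2 / 2 :=
    calc d * log 2 ≤ log 2 / (2 * (c + 1)) * (c * d + d) := by
          refine hlow.trans (hle.trans ?_)
          gcongr
      _ = _ := by field_simp
  have : 0 < d * log 2 := by positivity
  linarith

/-- Theorem 5.1(1): the approximation problem `I_d : H^{r,*}(S^d) → L₂(S^d)` is
`(s,t)`-weakly tractable for the absolute error criterion if and only if
`s·r > 1` or `t > 1`. -/
theorem sobolev_star_sphere_weak_tractability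
    (r s t : ℝ) (hr : 0 < r) (hs : 0 < s) (ht : 0 < t)
    (kf : ℕ → ℕ → ℕ)
    (hkf : ∀ d : ℕ, 2 ≤ d → ∀ n : ℕ, 1 ≤ n →
      (n : ℝ) ≤ sphC d (kf d n) ∧ (0 < kf d n → sphC d (kf d n - 1) < (n : ℝ))) :
    (∀ δ : ℝ, 0 < δ → ∃ M : ℝ, 0 < M ∧
      ∀ d : ℕ, 2 ≤ d → ∀ ε : ℝ, 0 < ε → ε < 1 → M ≤ ε⁻¹ + d →
        Real.log (infoComplexity r d kf ε) ≤ δ * (ε ^ (-s) + (d : ℝ) ^ t))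
    ↔ (1 < s * r ∨ 1 < t) := by
  refine ⟨one_lt_or_one_lt_of_two_pow_le hr hs
    fun d hd ↦ two_pow_le_infoComplexity hr hd (hkf d hd), fun hst δ hδ ↦ ?_⟩
  have hlog2 : 0 < log 2 := log_pos one_lt_two
  obtain ⟨C, hC, hbound⟩ : ∃ C : ℝ, 0 ≤ C ∧ ∀ d : ℕ, 2 ≤ d → ∀ ε : ℝ, 0 < ε → ε < 1 →
      log (infoComplexity r d kf ε) ≤ C + δ / 2 * (ε⁻¹ ^ s + (d : ℝ) ^ t) := by
    rcases hst with hsr | ht1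
    · obtain ⟨C, hC, h⟩ := exists_rpow_le_mul_rpow_add (one_div_pos.2 hr)
        ((div_lt_iff₀ hr).2 hsr) (by positivity : 0 < δ / 6)
      refine ⟨log 2 + 3 * C, by positivity, fun d hd ε hε hε1 ↦ ?_⟩
      have h₁ := (log_infoComplexity_le hr hd (fun n hn ↦ (hkf d hd n hn).1) hε).1
      have h₂ : 0 ≤ δ / 2 * (d : ℝ) ^ t := by positivity
      linarith [h ε⁻¹ ((one_lt_inv₀ hε).2 hε1).le]
    · obtain ⟨C, hC, h⟩ := exists_mul_log_le (one_div_pos.2 hr) hs ht1 (half_pos hδ)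
      refine ⟨log 2 + C, by positivity, fun d hd ε hε hε1 ↦ ?_⟩
      have h₁ := (log_infoComplexity_le hr hd (fun n hn ↦ (hkf d hd n hn).1) hε).2
      linarith [h ε⁻¹ d ((one_lt_inv₀ hε).2 hε1).le (mod_cast (by omega : 1 ≤ d))]
  obtain ⟨M, hM0, hM⟩ := exists_const_le_mul_rpow_add_rpow hs ht (half_pos hδ) hC
  refine ⟨M, hM0, fun d hd ε hε hε1 hMle ↦ ?_⟩
  rw [rpow_neg_eq_inv_rpow]
  linarith [hbound d hd ε hε hε1, hM ε⁻¹ d (inv_pos.2 hε).le (Nat.cast_nonneg d) hMle]
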